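/- arXiv:1912.12870 — 5 statements merged into one kernel-verified Lean document; each statement's English description precedes it below -/
import Mathlib

section
/- (Estimating equation for the separable-plus-banded model.) Let 0 ≤ δ* ≤ δ < 1, let a₁, a₂ : [0,1]² → ℝ be continuous, let b : [0,1]⁴ → ℝ be continuous and banded by δ* (i.e. b(t,s,t',s') = 0 whenever max(|t-t'|,|s-s'|) ≥ δ*), and set c(t,s,t',s') = a₁(t,t')·a₂(s,s') + b(t,s,t',s'). Then for all t,s,t',s' ∈ [0,1]: ( ∫₀^{1-δ}∫₀^{1-δ} c(u,v,u+δ,v+δ) du dv ) · a₁(t,t')·a₂(s,s') = ( ∫₀^{1-δ} c(t,v,t',v+δ) dv ) · ( ∫₀^{1-δ} c(u,s,u+δ,s') du ). In particular, the shifted trace of c equals Tr^δ(a₁)·Tr^δ(a₂), where Tr^δ(aᵢ) = ∫₀^{1-δ} aᵢ(u,u+δ) du. -/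
open MeasureTheory

/-- **Estimating equation for the separable-plus-banded model** (kernel form).
If `c = a₁ ⊗ a₂ + b` with `a₁, a₂` continuous and `b` continuous and banded by
`δ* ≤ δ < 1`, then `Tr^δ(c)·a₁(t,t')·a₂(s,s') = Tr₁^δ(c)(t,t')·Tr₂^δ(c)(s,s')`
for all `t,s,t',s' ∈ [0,1]`; in particular `Tr^δ(c) = Tr^δ(a₁)·Tr^δ(a₂)`. -/
theorem estimating_equation_separable_plus_banded
    (δstar δ : ℝ) (hδstar : 0 ≤ δstar) (hle : δstar ≤ δ) (hδ1 : δ < 1)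
    (a₁ a₂ : ℝ → ℝ → ℝ)
    (ha₁ : ContinuousOn (fun p : ℝ × ℝ => a₁ p.1 p.2) (Set.Icc (0:ℝ) 1 ×ˢ Set.Icc (0:ℝ) 1))
    (ha₂ : ContinuousOn (fun p : ℝ × ℝ => a₂ p.1 p.2) (Set.Icc (0:ℝ) 1 ×ˢ Set.Icc (0:ℝ) 1))
    (b : ℝ → ℝ → ℝ → ℝ → ℝ)
    (hbcont : ContinuousOn (fun p : ℝ × ℝ × ℝ × ℝ => b p.1 p.2.1 p.2.2.1 p.2.2.2)
      (Set.Icc (0:ℝ) 1 ×ˢ Set.Icc (0:ℝ) 1 ×ˢ Set.Icc (0:ℝ) 1 ×ˢ Set.Icc (0:ℝ) 1))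
    (hb : ∀ t s t' s' : ℝ, t ∈ Set.Icc (0:ℝ) 1 → s ∈ Set.Icc (0:ℝ) 1 →
      t' ∈ Set.Icc (0:ℝ) 1 → s' ∈ Set.Icc (0:ℝ) 1 →
      δstar ≤ max |t - t'| |s - s'| → b t s t' s' = 0)
    (c : ℝ → ℝ → ℝ → ℝ → ℝ)
    (hc : ∀ t s t' s', c t s t' s' = a₁ t t' * a₂ s s' + b t s t' s') :
    (∀ t s t' s' : ℝ, t ∈ Set.Icc (0:ℝ) 1 → s ∈ Set.Icc (0:ℝ) 1 →
        t' ∈ Set.Icc (0:ℝ) 1 → s' ∈ Set.Icc (0:ℝ) 1 →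
      (∫ u in (0:ℝ)..(1 - δ), ∫ v in (0:ℝ)..(1 - δ), c u v (u + δ) (v + δ)) *
          (a₁ t t' * a₂ s s') =
        (∫ v in (0:ℝ)..(1 - δ), c t v t' (v + δ)) *
          (∫ u in (0:ℝ)..(1 - δ), c u s (u + δ) s')) ∧
    ((∫ u in (0:ℝ)..(1 - δ), ∫ v in (0:ℝ)..(1 - δ), c u v (u + δ) (v + δ)) =
        (∫ u in (0:ℝ)..(1 - δ), a₁ u (u + δ)) * (∫ v in (0:ℝ)..(1 - δ), a₂ v (v + δ))) := by
  have h1δ : 0 ≤ 1 - δ := by linarith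
  have hmem : ∀ u ∈ Set.uIcc (0:ℝ) (1 - δ),
      u ∈ Set.Icc (0:ℝ) 1 ∧ u + δ ∈ Set.Icc (0:ℝ) 1 := by
    intro u hu
    rw [Set.uIcc_of_le h1δ] at hu
    obtain ⟨h0, h1⟩ := hu
    exact ⟨⟨h0, by linarith⟩, ⟨by linarith, by linarith⟩⟩
  have hδabs : ∀ u : ℝ, δstar ≤ |u - (u + δ)| := fun u => by
    rw [sub_add_cancel_left, abs_neg]
    exact hle.trans (le_abs_self δ)
  have hTr₁ : ∀ t t' : ℝ, t ∈ Set.Icc (0:ℝ) 1 → t' ∈ Set.Icc (0:ℝ) 1 →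
      ∫ v in (0:ℝ)..(1 - δ), c t v t' (v + δ) =
        a₁ t t' * ∫ v in (0:ℝ)..(1 - δ), a₂ v (v + δ) := by
    intro t t' ht ht'
    rw [← intervalIntegral.integral_const_mul]
    refine intervalIntegral.integral_congr fun v hv => ?_
    obtain ⟨hv₁, hv₂⟩ := hmem v hv
    simp only [hc, hb t v t' (v + δ) ht hv₁ ht' hv₂ ((hδabs v).trans (le_max_right _ _)),
      add_zero]
  have hTr₂ : ∀ s s' : ℝ, s ∈ Set.Icc (0:ℝ) 1 → s' ∈ Set.Icc (0:ℝ) 1 →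
      ∫ u in (0:ℝ)..(1 - δ), c u s (u + δ) s' =
        (∫ u in (0:ℝ)..(1 - δ), a₁ u (u + δ)) * a₂ s s' := by
    intro s s' hs hs'
    rw [← intervalIntegral.integral_mul_const]
    refine intervalIntegral.integral_congr fun u hu => ?_
    obtain ⟨hu₁, hu₂⟩ := hmem u hu
    simp only [hc, hb u s (u + δ) s' hu₁ hs hu₂ hs' ((hδabs u).trans (le_max_left _ _)),
      add_zero]
  have hTr : (∫ u in (0:ℝ)..(1 - δ), ∫ v in (0:ℝ)..(1 - δ), c u v (u + δ) (v + δ)) =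
      (∫ u in (0:ℝ)..(1 - δ), a₁ u (u + δ)) * (∫ v in (0:ℝ)..(1 - δ), a₂ v (v + δ)) := by
    rw [← intervalIntegral.integral_mul_const]
    refine intervalIntegral.integral_congr fun u hu => ?_
    exact hTr₁ u (u + δ) (hmem u hu).1 (hmem u hu).2
  refine ⟨fun t s t' s' ht hs ht' hs' => ?_, hTr⟩
  rw [hTr, hTr₁ t t' ht ht', hTr₂ s s' hs hs']
  ring
end

section
/- (Discrete estimating equation.) Let K₁, K₂, d ∈ ℕ with d ≤ K₁ and d ≤ K₂. Let A₁ : Fin K₁ → Fin K₁ → ℝ, A₂ : Fin K₂ → Fin K₂ → ℝ, and let B : Fin K₁ → Fin K₂ → Fin K₁ → Fin K₂ → ℝ satisfy B i j k l = 0 whenever |（i:ℤ) - k| ≥ d or |（j:ℤ) - l| ≥ d. Define C i j k l = A₁ i k · A₂ j l + B i j k l. Then for all i, k ∈ Fin K₁ and j, l ∈ Fin K₂: ( Σ_{i'=0}^{K₁-d-1} Σ_{j'=0}^{K₂-d-1} C i' j' (i'+d) (j'+d) ) · ( A₁ i k · A₂ j l ) = ( Σ_{j'=0}^{K₂-d-1}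 C i j' k (j'+d) ) · ( Σ_{i'=0}^{K₁-d-1} C i' j (i'+d) l ), where indices like i'+d denote the corresponding element of Fin K₁ (which is well-defined since i' < K₁ - d). -/
/-- **Discrete estimating equation.** For a separable-plus-banded array
`C i j k l = A₁ i k · A₂ j l + B i j k l` with `B` banded by the discrete
bandwidth `d`, shifted partial tracing satisfies
`Tr^d(C) · (A₁ ⊗ A₂) = Tr₁^d(C) ⊗ Tr₂^d(C)`. -/
theorem discrete_estimating_equation
    (K₁ K₂ d : ℕ) (hd₁ : d ≤ K₁) (hd₂ : d ≤ K₂)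
    (A₁ : Fin K₁ → Fin K₁ → ℝ) (A₂ : Fin K₂ → Fin K₂ → ℝ)
    (B : Fin K₁ → Fin K₂ → Fin K₁ → Fin K₂ → ℝ)
    (hB : ∀ (i k : Fin K₁) (j l : Fin K₂),
      ((d : ℤ) ≤ |(i : ℤ) - (k : ℤ)| ∨ (d : ℤ) ≤ |(j : ℤ) - (l : ℤ)|) → B i j k l = 0)
    (C : Fin K₁ → Fin K₂ → Fin K₁ → Fin K₂ → ℝ)
    (hC : ∀ i j k l, C i j k l = A₁ i k * A₂ j l + B i j k l) :
    ∀ (i k : Fin K₁) (j l : Fin K₂),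
      (∑ i' : Fin (K₁ - d), ∑ j' : Fin (K₂ - d),
          C ⟨i'.val, by have := i'.isLt; omega⟩ ⟨j'.val, by have := j'.isLt; omega⟩
            ⟨i'.val + d, by have := i'.isLt; omega⟩ ⟨j'.val + d, by have := j'.isLt; omega⟩) *
        (A₁ i k * A₂ j l) =
      (∑ j' : Fin (K₂ - d),
          C i ⟨j'.val, by have := j'.isLt; omega⟩ k ⟨j'.val + d, by have := j'.isLt; omega⟩) *
        (∑ i' : Fin (K₁ - d),
          C ⟨i'.val, by have := i'.isLt; omega⟩ j ⟨i'.val + d, by have := i'.isLt; omega⟩ l) := by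
  have hC₁ (i k : Fin K₁) (j l : Fin K₂) (h : j.val + d = l.val) :
      C i j k l = A₁ i k * A₂ j l := by
    rw [hC, hB i k j l (Or.inr (by rw [le_abs]; omega)), add_zero]
  have hC₂ (i k : Fin K₁) (j l : Fin K₂) (h : i.val + d = k.val) :
      C i j k l = A₁ i k * A₂ j l := by
    rw [hC, hB i k j l (Or.inl (by rw [le_abs]; omega)), add_zero]
  intro i k j l
  have hTr₁ (i k : Fin K₁) (j' : Fin (K₂ - d)) :=
    hC₁ i k ⟨j'.val, by omega⟩ ⟨j'.val + d, by omega⟩ rfl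
  have hTr₂ (j l : Fin K₂) (i' : Fin (K₁ - d)) :=
    hC₂ ⟨i'.val, by omega⟩ ⟨i'.val + d, by omega⟩ j l rfl
  simp only [hTr₁, hTr₂, ← Finset.mul_sum, ← Finset.sum_mul]
  ring
end

section
/- (Analytic solution of the discrete Stein equation arising in the ADI sub-problem.) Let K ∈ ℕ, let U, V ∈ Matrix (Fin K) (Fin K) ℝ be orthogonal (Uᵀ * U = 1 = U * Uᵀ and Vᵀ * V = 1 = V * Vᵀ), let φ, ψ : Fin K → ℝ, set A₁ = U * Matrix.diagonal φ * Uᵀ and A₂ = V * Matrix.diagonal ψ * Vᵀ, and let ρ ∈ ℝ satisfy ψ i · φ j + ρ ≠ 0 for all i, j. Given Y ∈ Matrix (Fin K) (Fin K) ℝ, define G ∈ Matrix (Fin K) (Fin K) ℝ by G i j = (ψ i · φ j + ρ)⁻¹ and set X = V * (G ⊙ (Vᵀ * Y * U)) * Uᵀ, where ⊙ denotes the Hadamard (entrywise) product. Then A₂ * X * A₁ + ρ • X = Y. -/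
open Matrix

/-- If `G` is the entrywise inverse of `ψ i * φ j + ρ`, then `G ⊙ M` solves the Stein equation
with diagonal coefficients and right-hand side `M`. -/
theorem diagonal_mul_hadamard_mul_diagonal_add_smul {m n R : Type*} [Fintype m] [Fintype n]
    [DecidableEq m] [DecidableEq n] [Field R] (φ : n → R) (ψ : m → R) (ρ : R)
    (hρ : ∀ i j, ψ i * φ j + ρ ≠ 0) (G M : Matrix m n R)
    (hG : ∀ i j, G i j = (ψ i * φ j + ρ)⁻¹) :
    diagonal ψ * hadamard G M * diagonal φ + ρ • hadamard G M = M := by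
  ext i j
  simp only [Matrix.add_apply, mul_diagonal, diagonal_mul, Matrix.smul_apply, hadamard_apply,
    smul_eq_mul, hG]
  have h := hρ i j
  field_simp

/-- **Analytic solution of the discrete Stein equation** arising as the first
sub-problem of the paper's ADI inversion scheme: with `A₁ = U diag(φ) Uᵀ`,
`A₂ = V diag(ψ) Vᵀ` (`U`, `V` orthogonal), `G i j = (ψ i·φ j + ρ)⁻¹`, the matrix
`X = V (G ⊙ (Vᵀ Y U)) Uᵀ` solves `A₂ X A₁ + ρ X = Y`. -/
theorem stein_equation_solution
    (K : ℕ) (U V : Matrix (Fin K) (Fin K) ℝ)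
    (hU₁ : Uᵀ * U = 1) (hU₂ : U * Uᵀ = 1)
    (hV₁ : Vᵀ * V = 1) (hV₂ : V * Vᵀ = 1)
    (φ ψ : Fin K → ℝ) (ρ : ℝ)
    (hρ : ∀ i j, ψ i * φ j + ρ ≠ 0)
    (Y G : Matrix (Fin K) (Fin K) ℝ)
    (hG : ∀ i j, G i j = (ψ i * φ j + ρ)⁻¹) :
    (V * Matrix.diagonal ψ * Vᵀ) *
        (V * (Matrix.hadamard G (Vᵀ * Y * U)) * Uᵀ) *
        (U * Matrix.diagonal φ * Uᵀ) +
      ρ • (V * (Matrix.hadamard G (Vᵀ * Y * U)) * Uᵀ) = Y := by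
  set H := hadamard G (Vᵀ * Y * U) with hH
  calc
    _ = V * diagonal ψ * (Vᵀ * V) * H * (Uᵀ * U) * diagonal φ * Uᵀ + ρ • (V * H * Uᵀ) := by
      simp only [Matrix.mul_assoc]
    _ = V * (diagonal ψ * H * diagonal φ + ρ • H) * Uᵀ := by
      simp only [hV₁, hU₁, Matrix.mul_one, Matrix.mul_add, Matrix.add_mul, Matrix.mul_smul,
        Matrix.smul_mul, Matrix.mul_assoc]
    _ = V * (Vᵀ * Y * U) * Uᵀ := by
      rw [hH, diagonal_mul_hadamard_mul_diagonal_add_smul φ ψ ρ hρ G _ hG]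
    _ = (V * Vᵀ) * Y * (U * Uᵀ) := by simp only [Matrix.mul_assoc]
    _ = Y := by rw [hV₂, hU₂, Matrix.one_mul, Matrix.mul_one]
end

section
/- Let K₁, K₂ ≥ 1, let M : Fin K₁ → Fin K₂ → Fin K₁ → Fin K₂ → ℝ, and let δ ∈ [0,1) be such that d₁ = δ·K₁ and d₂ = δ·K₂ are natural numbers. Let k : [0,1)⁴ → ℝ be the piecewise constant continuation of M, i.e. k(t,s,t',s') = M ⌊K₁t⌋ ⌊K₂s⌋ ⌊K₁t'⌋ ⌊K₂s'⌋ (floors interpreted as elements of Fin K₁, Fin K₂). Then the continuous δ-shifted trace of k equals the normalized discrete d-shifted trace of M: ∫₀^{1-δ}∫₀^{1-δ} k(t,s,t+δ,s+δ) dt ds = (1/(K₁·K₂)) · Σ_{i=0}^{K₁-d₁-1} Σ_{j=0}^{K₂-d₂-1} M i j (i+d₁) (j+d₂). -/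
open MeasureTheory

theorem floor_eqOn_Ico_natCast {E : Type*} (f : ℕ → E) (i : ℕ) :
    Set.EqOn (fun x : ℝ => f ⌊x⌋₊) (fun _ => f i) (Set.Ico (i : ℝ) ((i + 1 : ℕ) : ℝ)) := by
  intro x hx
  have h : ⌊x⌋₊ = i := Nat.floor_eq_on_Ico i x (by simpa using hx)
  simp only [h]

theorem ae_floor_eq_of_mem_uIoc {E : Type*} (f : ℕ → E) (i : ℕ) :
    ∀ᵐ x : ℝ, x ∈ Set.uIoc (i : ℝ) ((i + 1 : ℕ) : ℝ) → f ⌊x⌋₊ = f i := by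
  filter_upwards [Measure.ae_ne volume ((i + 1 : ℕ) : ℝ)] with x hx hmem
  rw [Set.uIoc_of_le (by simp)] at hmem
  exact floor_eqOn_Ico_natCast f i ⟨hmem.1.le, lt_of_le_of_ne hmem.2 hx⟩

theorem intervalIntegrable_floor {E : Type*} [NormedAddCommGroup E] (f : ℕ → E) (i : ℕ) :
    IntervalIntegrable (fun x : ℝ => f ⌊x⌋₊) volume (i : ℝ) ((i + 1 : ℕ) : ℝ) :=
  (intervalIntegrable_const (c := f i)).congr_ae <| by
    rw [Filter.EventuallyEq, ae_restrict_iff' measurableSet_uIoc]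
    filter_upwards [ae_floor_eq_of_mem_uIoc f i] with x hx hmem using (hx hmem).symm

theorem integral_floor_eq_sum {E : Type*} [NormedAddCommGroup E] [NormedSpace ℝ E]
    [CompleteSpace E] (f : ℕ → E) (n : ℕ) :
    ∫ x in (0 : ℝ)..n, f ⌊x⌋₊ = ∑ i ∈ Finset.range n, f i := by
  have h := intervalIntegral.sum_integral_adjacent_intervals (n := n)
    (a := fun i : ℕ => (i : ℝ)) (fun i _ => intervalIntegrable_floor f i)
  rw [Nat.cast_zero] at h
  rw [← h]
  refine Finset.sum_congr rfl fun i _ => ?_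
  rw [intervalIntegral.integral_congr_ae (ae_floor_eq_of_mem_uIoc f i)]
  simp

theorem integral_floor_mul_eq_sum {E : Type*} [NormedAddCommGroup E] [NormedSpace ℝ E]
    [CompleteSpace E] (f : ℕ → E) {K n : ℕ} (hK : 0 < K) {a : ℝ} (ha : K * a = n) :
    ∫ t in (0 : ℝ)..a, f ⌊(K : ℝ) * t⌋₊ = (K : ℝ)⁻¹ • ∑ i ∈ Finset.range n, f i := by
  rw [intervalIntegral.integral_comp_mul_left (fun x => f ⌊x⌋₊) (by positivity : (K : ℝ) ≠ 0),
    mul_zero, ha, integral_floor_eq_sum]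

theorem floor_mul_add_eq {K d : ℕ} {δ t : ℝ} (hd : (d : ℝ) = δ * K) (ht : 0 ≤ t) :
    ⌊(K : ℝ) * (t + δ)⌋₊ = ⌊(K : ℝ) * t⌋₊ + d := by
  rw [mul_add, mul_comm (K : ℝ) δ, ← hd, Nat.floor_add_natCast (by positivity)]

theorem mul_one_sub_eq_natCast_sub {K d : ℕ} {δ : ℝ} (hδ : δ ≤ 1) (hd : (d : ℝ) = δ * K) :
    (K : ℝ) * (1 - δ) = (K - d : ℕ) := by
  have h : d ≤ K := by
    have : (d : ℝ) ≤ K := hd.trans_le (mul_le_of_le_one_left K.cast_nonneg hδ)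
    exact_mod_cast this
  rw [Nat.cast_sub h, hd]
  ring

/-- **Continuous vs. discrete shifted trace** (part 3 of the paper's Lemma B.6).
For the piecewise constant continuation `k` of a 4-way array `M` on a `K₁ × K₂` grid
and a bandwidth `δ` with `δ·K₁ = d₁` and `δ·K₂ = d₂` natural numbers, the continuous
δ-shifted trace of `k` equals `(K₁K₂)⁻¹` times the discrete `(d₁,d₂)`-shifted trace
of `M`. -/
theorem continuous_discrete_shifted_trace
    (K₁ K₂ : ℕ) (hK₁ : 0 < K₁) (hK₂ : 0 < K₂)
    (M : Fin K₁ → Fin K₂ → Fin K₁ → Fin K₂ → ℝ)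
    (δ : ℝ) (hδ0 : 0 ≤ δ) (hδ1 : δ < 1)
    (d₁ d₂ : ℕ) (hd₁ : (d₁ : ℝ) = δ * K₁) (hd₂ : (d₂ : ℝ) = δ * K₂) :
    (∫ t in (0:ℝ)..(1 - δ), ∫ s in (0:ℝ)..(1 - δ),
        M ⟨⌊(K₁ : ℝ) * t⌋₊ % K₁, Nat.mod_lt _ hK₁⟩
          ⟨⌊(K₂ : ℝ) * s⌋₊ % K₂, Nat.mod_lt _ hK₂⟩
          ⟨⌊(K₁ : ℝ) * (t + δ)⌋₊ % K₁, Nat.mod_lt _ hK₁⟩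
          ⟨⌊(K₂ : ℝ) * (s + δ)⌋₊ % K₂, Nat.mod_lt _ hK₂⟩) =
      (1 / ((K₁ : ℝ) * (K₂ : ℝ))) *
        ∑ i : Fin (K₁ - d₁), ∑ j : Fin (K₂ - d₂),
          M ⟨i.val, by have := i.isLt; omega⟩ ⟨j.val, by have := j.isLt; omega⟩
            ⟨i.val + d₁, by have := i.isLt; omega⟩ ⟨j.val + d₂, by have := j.isLt; omega⟩ := by
  let g : ℕ → ℕ → ℝ := fun a b =>
    M ⟨a % K₁, Nat.mod_lt _ hK₁⟩ ⟨b % K₂, Nat.mod_lt _ hK₂⟩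
      ⟨(a + d₁) % K₁, Nat.mod_lt _ hK₁⟩ ⟨(b + d₂) % K₂, Nat.mod_lt _ hK₂⟩
  have hpos : ∀ t ∈ Set.uIcc 0 (1 - δ), 0 ≤ t := fun t ht => by
    rw [Set.uIcc_of_le (by linarith)] at ht
    exact ht.1
  calc
    _ = ∫ t in (0 : ℝ)..(1 - δ), ∫ s in (0 : ℝ)..(1 - δ),
          g ⌊(K₁ : ℝ) * t⌋₊ ⌊(K₂ : ℝ) * s⌋₊ := by
      refine intervalIntegral.integral_congr fun t ht => ?_
      refine intervalIntegral.integral_congr fun s hs => ?_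
      simp only [g, floor_mul_add_eq hd₁ (hpos t ht), floor_mul_add_eq hd₂ (hpos s hs)]
    _ = ∫ t in (0 : ℝ)..(1 - δ),
          (K₂ : ℝ)⁻¹ • ∑ j ∈ Finset.range (K₂ - d₂), g ⌊(K₁ : ℝ) * t⌋₊ j := by
      refine intervalIntegral.integral_congr fun t _ => ?_
      exact integral_floor_mul_eq_sum (g ⌊(K₁ : ℝ) * t⌋₊) hK₂
        (mul_one_sub_eq_natCast_sub hδ1.le hd₂)
    _ = (K₁ : ℝ)⁻¹ • ∑ i ∈ Finset.range (K₁ - d₁),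
          (K₂ : ℝ)⁻¹ • ∑ j ∈ Finset.range (K₂ - d₂), g i j :=
      integral_floor_mul_eq_sum
        (fun i => (K₂ : ℝ)⁻¹ • ∑ j ∈ Finset.range (K₂ - d₂), g i j) hK₁
        (mul_one_sub_eq_natCast_sub hδ1.le hd₁)
    _ = _ := by
      rw [← Finset.smul_sum, smul_smul, smul_eq_mul, one_div, mul_inv, Finset.sum_range]
      congr 1
      refine Finset.sum_congr rfl fun i _ => ?_
      rw [Finset.sum_range]
      refine Finset.sum_congr rfl fun j _ => ?_
      have hi := i.isLt
      have hj := j.isLt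
      simp only [g, Nat.mod_eq_of_lt (show i.val < K₁ by omega),
        Nat.mod_eq_of_lt (show j.val < K₂ by omega),
        Nat.mod_eq_of_lt (show i.val + d₁ < K₁ by omega),
        Nat.mod_eq_of_lt (show j.val + d₂ < K₂ by omega)]
end

section
/- Let K₁, K₂ ≥ 1, let M : Fin K₁ → Fin K₂ → Fin K₁ → Fin K₂ → ℝ, and let δ ∈ [0,1) be such that d = δ·K₂ is a natural number. Let k : [0,1)⁴ → ℝ be the piecewise constant continuation of M, i.e. k(t,s,t',s') = M ⌊K₁t⌋ ⌊K₂s⌋ ⌊K₁t'⌋ ⌊K₂s'⌋. Then the squared L² norm of the continuous δ-shifted partial trace of k equals the correspondingly normalized squared Frobenius norm of the discrete d-shifted partial trace of M: ∫₀¹∫₀¹ ( ∫₀^{1-δ} k(t,s,t',s+δ) ds )² dt dt' = (1/(K₁·K₂))² · Σ_{i=0}^{K₁-1} Σ_{k=0}^{K₁-1} ( Σ_{j=0}^{K₂-d-1} M i j k (j+d) )². -/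
open MeasureTheory

theorem intervalIntegrable_comp_natFloor_unit (g : ℕ → ℝ) (j : ℕ) :
    IntervalIntegrable (fun u : ℝ => g ⌊u⌋₊) volume (j : ℝ) ((j + 1 : ℕ) : ℝ) := by
  refine (intervalIntegrable_const (c := g j)).congr_uIoo fun u hu => ?_
  rw [Set.uIoo_of_le (by simp)] at hu
  have : ⌊u⌋₊ = j :=
    (Nat.floor_eq_iff (j.cast_nonneg.trans hu.1.le)).2 ⟨hu.1.le, by exact_mod_cast hu.2⟩
  simp [this]

theorem integral_comp_natFloor_unit (g : ℕ → ℝ) (j : ℕ) :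
    ∫ u in (j : ℝ)..((j + 1 : ℕ) : ℝ), g ⌊u⌋₊ = g j := by
  rw [intervalIntegral.integral_congr_uIoo (g := fun _ => g j)]
  · simp
  · intro u hu
    rw [Set.uIoo_of_le (by simp)] at hu
    have : ⌊u⌋₊ = j :=
      (Nat.floor_eq_iff (j.cast_nonneg.trans hu.1.le)).2 ⟨hu.1.le, by exact_mod_cast hu.2⟩
    simp [this]

/-- The integral over `[0, n / K]` of a step function on the grid of mesh `1 / K`. -/
theorem integral_comp_natFloor_mul (g : ℕ → ℝ) {K : ℕ} (hK : 0 < K) (n : ℕ) :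
    ∫ t in (0 : ℝ)..(n / K : ℝ), g ⌊(K : ℝ) * t⌋₊ =
      (1 / (K : ℝ)) * ∑ j ∈ Finset.range n, g j := by
  have hK' : (K : ℝ) ≠ 0 := by positivity
  have hsum := intervalIntegral.sum_integral_adjacent_intervals
    (a := fun j : ℕ => (j : ℝ)) (n := n)
    fun j _ => intervalIntegrable_comp_natFloor_unit g j
  simp only [integral_comp_natFloor_unit, Nat.cast_zero] at hsum
  rw [intervalIntegral.integral_comp_mul_left (fun u : ℝ => g ⌊u⌋₊) hK', mul_zero,
    mul_div_cancel₀ _ hK', ← hsum, smul_eq_mul, one_div]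

theorem integral_comp_natFloor_mul_mod {K : ℕ} (hK : 0 < K) (g : Fin K → ℝ) :
    ∫ t in (0 : ℝ)..1, g ⟨⌊(K : ℝ) * t⌋₊ % K, Nat.mod_lt _ hK⟩ =
      (1 / (K : ℝ)) * ∑ i, g i := by
  have hK' : (K : ℝ) ≠ 0 := by positivity
  have h := integral_comp_natFloor_mul (fun m => g ⟨m % K, Nat.mod_lt _ hK⟩) hK K
  rw [div_self hK'] at h
  rw [h, ← Fin.sum_univ_eq_sum_range (fun m => g ⟨m % K, Nat.mod_lt _ hK⟩)]
  simp only [Nat.mod_eq_of_lt (Fin.is_lt _)]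

theorem integral_shifted_diagonal {K : ℕ} (hK : 0 < K) (A : Fin K → Fin K → ℝ)
    {δ : ℝ} (hδ : δ < 1) {d : ℕ} (hd : (d : ℝ) = δ * K) :
    ∫ s in (0 : ℝ)..(1 - δ),
        A ⟨⌊(K : ℝ) * s⌋₊ % K, Nat.mod_lt _ hK⟩
          ⟨⌊(K : ℝ) * (s + δ)⌋₊ % K, Nat.mod_lt _ hK⟩ =
      (1 / (K : ℝ)) * ∑ j : Fin (K - d),
        A ⟨j.val, by have := j.isLt; omega⟩ ⟨j.val + d, by have := j.isLt; omega⟩ := by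
  have hK' : (0 : ℝ) < K := by positivity
  have hdK : d ≤ K := by
    have : (d : ℝ) ≤ K := by rw [hd]; nlinarith
    exact_mod_cast this
  have hend : 1 - δ = ((K - d : ℕ) : ℝ) / K := by
    rw [Nat.cast_sub hdK, hd]; field_simp
  let g : ℕ → ℝ := fun m => A ⟨m % K, Nat.mod_lt _ hK⟩ ⟨(m + d) % K, Nat.mod_lt _ hK⟩
  have hcongr : Set.EqOn
      (fun s : ℝ => A ⟨⌊(K : ℝ) * s⌋₊ % K, Nat.mod_lt _ hK⟩
        ⟨⌊(K : ℝ) * (s + δ)⌋₊ % K, Nat.mod_lt _ hK⟩)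
      (fun s => g ⌊(K : ℝ) * s⌋₊) (Set.uIcc 0 (1 - δ)) := by
    intro s hs
    rw [Set.uIcc_of_le (by linarith)] at hs
    have : (K : ℝ) * (s + δ) = K * s + d := by rw [hd]; ring
    simp only [g, this, Nat.floor_add_natCast (mul_nonneg hK'.le hs.1)]
  rw [intervalIntegral.integral_congr hcongr, hend, integral_comp_natFloor_mul g hK,
    ← Fin.sum_univ_eq_sum_range]
  congr 1
  refine Finset.sum_congr rfl fun j _ => ?_
  have hj := j.isLt
  simp only [g, Nat.mod_eq_of_lt (show j.val < K by omega),
    Nat.mod_eq_of_lt (show j.val + d < K by omega)]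

/-- **Continuous vs. discrete shifted partial trace** (part 1 of the paper's
Lemma B.6). For the piecewise constant continuation `k` of a 4-way array `M` on a
`K₁ × K₂` grid and a bandwidth `δ` with `δ·K₂ = d` a natural number, the squared L²
norm of the continuous δ-shifted partial trace of `k` equals `(K₁K₂)⁻²` times the
squared Frobenius norm of the discrete d-shifted partial trace of `M`. -/
theorem continuous_discrete_shifted_partial_trace
    (K₁ K₂ : ℕ) (hK₁ : 0 < K₁) (hK₂ : 0 < K₂)
    (M : Fin K₁ → Fin K₂ → Fin K₁ → Fin K₂ → ℝ)
    (δ : ℝ) (hδ0 : 0 ≤ δ) (hδ1 : δ < 1)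
    (d : ℕ) (hd : (d : ℝ) = δ * K₂) :
    (∫ t in (0:ℝ)..1, ∫ t' in (0:ℝ)..1,
        (∫ s in (0:ℝ)..(1 - δ),
          M ⟨⌊(K₁ : ℝ) * t⌋₊ % K₁, Nat.mod_lt _ hK₁⟩
            ⟨⌊(K₂ : ℝ) * s⌋₊ % K₂, Nat.mod_lt _ hK₂⟩
            ⟨⌊(K₁ : ℝ) * t'⌋₊ % K₁, Nat.mod_lt _ hK₁⟩
            ⟨⌊(K₂ : ℝ) * (s + δ)⌋₊ % K₂, Nat.mod_lt _ hK₂⟩) ^ 2) =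
      (1 / ((K₁ : ℝ) * (K₂ : ℝ))) ^ 2 *
        ∑ i : Fin K₁, ∑ k : Fin K₁,
          (∑ j : Fin (K₂ - d),
            M i ⟨j.val, by have := j.isLt; omega⟩
              k ⟨j.val + d, by have := j.isLt; omega⟩) ^ 2 := by
  let S : Fin K₁ → Fin K₁ → ℝ := fun i k => ∑ j : Fin (K₂ - d),
    M i ⟨j.val, by have := j.isLt; omega⟩ k ⟨j.val + d, by have := j.isLt; omega⟩
  have hinner (i k : Fin K₁) := integral_shifted_diagonal hK₂ (fun a b => M i a k b) hδ1 hd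
  simp only [hinner]
  have hmid (i : Fin K₁) :=
    integral_comp_natFloor_mul_mod hK₁ (fun k => ((1 / (K₂ : ℝ)) * S i k) ^ 2)
  have hout := integral_comp_natFloor_mul_mod hK₁
    (fun i => (1 / (K₁ : ℝ)) * ∑ k, ((1 / (K₂ : ℝ)) * S i k) ^ 2)
  simp only [S] at hmid hout
  simp only [hmid, hout]
  simp only [mul_pow, ← Finset.mul_sum]
  ring
end
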